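/- Let G be a spray on an open set U ⊆ ℝⁿ (n ≥ 2) and let dV = σ(x) dx¹⋯dxⁿ be a volume form on U. Then the spray Ĝ associated with (G, dV), defined by Ĝⁱ := Gⁱ − (S/(n+1)) yⁱ where S is the S-curvature of (G, dV), has vanishing χ-curvature: χ̂_k = 0 for all k, where χ̂ denotes the χ-curvature computed from the spray Ĝ by the same formulas as for G. -/

import Mathlib

open scoped BigOperators

noncomputable section

/-- Points/vectors in local coordinates on an open subset of `ℝⁿ`. -/
abbrev Vec (n : ℕ) := Fin n → ℝ

variable {n : ℕ}

/-- Partial derivative in the base (`x`) variable, in the `k`-th coordinate direction. -/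
noncomputable def pdx (f : Vec n → Vec n → ℝ) (k : Fin n) (x y : Vec n) : ℝ :=
  fderiv ℝ (fun x' => f x' y) x (Pi.single k 1)

/-- Partial derivative in the fiber (`y`) variable, in the `k`-th coordinate direction;
this is the operation denoted by a subscript `·k`. -/
noncomputable def pdy (f : Vec n → Vec n → ℝ) (k : Fin n) (x y : Vec n) : ℝ :=
  fderiv ℝ (fun y' => f x y') y (Pi.single k 1)

/-- Partial derivative of a function of `x` alone. -/
noncomputable def pd (f : Vec n → ℝ) (k : Fin n) (x : Vec n) : ℝ :=
  fderiv ℝ f x (Pi.single k 1)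

/-- `G` is a spray on the open set `U ⊆ ℝⁿ`: the coefficients `Gⁱ(x,y)` are smooth for
`x ∈ U`, `y ≠ 0`, and positively homogeneous of degree `2` in `y`. -/
def IsSpray (U : Set (Vec n)) (G : Fin n → Vec n → Vec n → ℝ) : Prop :=
  (∀ i, ContDiffOn ℝ (⊤ : ℕ∞) (fun p : Vec n × Vec n => G i p.1 p.2)
      (U ×ˢ {y : Vec n | y ≠ 0})) ∧
  (∀ i (x y : Vec n) (lam : ℝ), 0 < lam → G i x (lam • y) = lam ^ 2 * G i x y)

/-- `N^i_j := ∂G^i/∂y^j`. -/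
noncomputable def Nc (G : Fin n → Vec n → Vec n → ℝ) (i j : Fin n) (x y : Vec n) : ℝ :=
  pdy (G i) j x y

/-- `Γ^i_{jk} := ∂²G^i/∂y^j∂y^k`. -/
noncomputable def Ga (G : Fin n → Vec n → Vec n → ℝ) (i j k : Fin n) (x y : Vec n) : ℝ :=
  pdy (Nc G i j) k x y

/-- The horizontal derivative `δf/δx^k := ∂f/∂x^k − N^m_k ∂f/∂y^m`; for a scalar `f` this is
also the horizontal covariant derivative `f_{|k}`. -/
noncomputable def hd (G : Fin n → Vec n → Vec n → ℝ) (f : Vec n → Vec n → ℝ)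
    (k : Fin n) (x y : Vec n) : ℝ :=
  pdx f k x y - ∑ m, Nc G m k x y * pdy f m x y

/-- The four-index Riemann curvature tensor
`R_j{}^i{}_{kl} := δΓⁱ_{jl}/δx^k − δΓⁱ_{jk}/δx^l + Γⁱ_{ks}Γ^s_{jl} − Γ^s_{jk}Γⁱ_{ls}`. -/
noncomputable def Riem4 (G : Fin n → Vec n → Vec n → ℝ) (j i k l : Fin n)
    (x y : Vec n) : ℝ :=
  hd G (Ga G i j l) k x y - hd G (Ga G i j k) l x y
    + ∑ s, (Ga G i k s x y * Ga G s j l x y - Ga G s j k x y * Ga G i l s x y)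

/-- The two-index Riemann curvature `R^i_k := y^j R_j{}^i{}_{kl} y^l`. -/
noncomputable def Riem2 (G : Fin n → Vec n → Vec n → ℝ) (i k : Fin n)
    (x y : Vec n) : ℝ :=
  ∑ j, ∑ l, y j * Riem4 G j i k l x y * y l

/-- The χ-curvature `χ_k := −(1/6)(2 R^m_{k·m} + R^m_{m·k})`. -/
noncomputable def chi (G : Fin n → Vec n → Vec n → ℝ) (k : Fin n) (x y : Vec n) : ℝ :=
  -(1 / 6) * (2 * ∑ m, pdy (Riem2 G m k) m x y + ∑ m, pdy (Riem2 G m m) k x y)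

/-- The scalar `R := (1/(n−1)) R^m_m`. -/
noncomputable def Rsc (G : Fin n → Vec n → Vec n → ℝ) (x y : Vec n) : ℝ :=
  (1 / ((n : ℝ) - 1)) * ∑ m, Riem2 G m m x y

/-- `Π := ∂G^m/∂y^m`. -/
noncomputable def PiG (G : Fin n → Vec n → Vec n → ℝ) (x y : Vec n) : ℝ :=
  ∑ m, Nc G m m x y

/-- The S-curvature of `(G, dV)` for the volume form `dV = σ(x) dx¹⋯dxⁿ`:
`S := Π − y^m ∂(ln σ)/∂x^m`. -/
noncomputable def Scurv (G : Fin n → Vec n → Vec n → ℝ) (σ : Vec n → ℝ)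
    (x y : Vec n) : ℝ :=
  PiG G x y - ∑ m, y m * pd (fun x' => Real.log (σ x')) m x

/-- The spray `Ĝ` associated with `(G, dV)`: `Ĝⁱ := Gⁱ − (S/(n+1)) yⁱ`. -/
noncomputable def Ghat (G : Fin n → Vec n → Vec n → ℝ) (σ : Vec n → ℝ)
    (i : Fin n) (x y : Vec n) : ℝ :=
  G i x y - (Scurv G σ x y / ((n : ℝ) + 1)) * y i

/-- `σ` is the (positive, smooth) density of a volume form `dV = σ(x) dx¹⋯dxⁿ` on `U`. -/
def IsVolumeForm (U : Set (Vec n)) (σ : Vec n → ℝ) : Prop :=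
  ContDiffOn ℝ (⊤ : ℕ∞) σ U ∧ ∀ x ∈ U, 0 < σ x

/-- `G` is of isotropic curvature on `U`: `Rⁱ_k = R δⁱ_k − (1/2) R_{·k} yⁱ`. -/
def IsIsotropicCurv (U : Set (Vec n)) (G : Fin n → Vec n → Vec n → ℝ) : Prop :=
  ∀ x ∈ U, ∀ y : Vec n, y ≠ 0 → ∀ i k,
    Riem2 G i k x y
      = Rsc G x y * (if i = k then 1 else 0) - (1 / 2) * pdy (Rsc G) k x y * y i

/-- `G` is of scalar curvature on `U`: `Rⁱ_k = R δⁱ_k − τ_k yⁱ` for some functions `τ_k`,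
positively homogeneous of degree one in `y`, with `τ_k y^k = R`. -/
def IsScalarCurv (U : Set (Vec n)) (G : Fin n → Vec n → Vec n → ℝ) : Prop :=
  ∃ τ : Fin n → Vec n → Vec n → ℝ,
    (∀ k (x y : Vec n) (lam : ℝ), 0 < lam → τ k x (lam • y) = lam * τ k x y) ∧
    ∀ x ∈ U, ∀ y : Vec n, y ≠ 0 →
      (∑ k, τ k x y * y k) = Rsc G x y ∧
      ∀ i k, Riem2 G i k x y
        = Rsc G x y * (if i = k then 1 else 0) - τ k x y * y i

/-- The slit product `U × (ℝⁿ \ {0})`. -/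
def slit (U : Set (Vec n)) : Set (Vec n × Vec n) := U ×ˢ {y : Vec n | y ≠ 0}

/-- Smoothness of `f(x,y)` for `x ∈ U`, `y ≠ 0`. -/
def SlitSmooth (U : Set (Vec n)) (f : Vec n → Vec n → ℝ) : Prop :=
  ContDiffOn ℝ (⊤ : ℕ∞) (fun p : Vec n × Vec n => f p.1 p.2) (slit U)

/-- Infinitesimal homogeneity of degree `r` in `y`: `y^l f_{·l} = r f` on the slit product. -/
def EulerHom (U : Set (Vec n)) (r : ℝ) (f : Vec n → Vec n → ℝ) : Prop :=
  ∀ x ∈ U, ∀ y : Vec n, y ≠ 0 → ∑ l, y l * pdy f l x y = r * f x y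

theorem isOpen_slit {U : Set (Vec n)} (hU : IsOpen U) : IsOpen (slit U) :=
  hU.prod isOpen_ne

section Calculus

variable {U : Set (Vec n)} {f g : Vec n → Vec n → ℝ} {x y : Vec n}

theorem SlitSmooth.contDiffAt (hf : SlitSmooth U f) (hU : IsOpen U) (hx : x ∈ U) (hy : y ≠ 0) :
    ContDiffAt ℝ (⊤ : ℕ∞) (fun p : Vec n × Vec n => f p.1 p.2) (x, y) :=
  ContDiffOn.contDiffAt hf ((isOpen_slit hU).mem_nhds ⟨hx, hy⟩)

theorem SlitSmooth.differentiableAt (hf : SlitSmooth U f) (hU : IsOpen U) (hx : x ∈ U)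
    (hy : y ≠ 0) : DifferentiableAt ℝ (fun p : Vec n × Vec n => f p.1 p.2) (x, y) :=
  (hf.contDiffAt hU hx hy).differentiableAt (by simp)

theorem SlitSmooth.differentiableAt_left (hf : SlitSmooth U f) (hU : IsOpen U) (hx : x ∈ U)
    (hy : y ≠ 0) : DifferentiableAt ℝ (fun x' => f x' y) x :=
  (hf.differentiableAt hU hx hy).comp (f := fun x' => (x', y)) x (by fun_prop)

theorem SlitSmooth.differentiableAt_right (hf : SlitSmooth U f) (hU : IsOpen U) (hx : x ∈ U)
    (hy : y ≠ 0) : DifferentiableAt ℝ (fun y' => f x y') y :=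
  (hf.differentiableAt hU hx hy).comp (f := fun y' => (x, y')) y (by fun_prop)

theorem SlitSmooth.pdx_eq (hf : SlitSmooth U f) (hU : IsOpen U) (hx : x ∈ U) (hy : y ≠ 0)
    (k : Fin n) : pdx f k x y =
      fderiv ℝ (fun p : Vec n × Vec n => f p.1 p.2) (x, y) (Pi.single k 1, 0) := by
  have h := (hf.differentiableAt hU hx hy).hasFDerivAt.comp (f := fun x' => (x', y)) x
    (hasFDerivAt_prodMk_left x y)
  have h' : fderiv ℝ (fun x' => f x' y) x = _ := h.fderiv
  simp [pdx, h']

theorem SlitSmooth.pdy_eq (hf : SlitSmooth U f) (hU : IsOpen U) (hx : x ∈ U) (hy : y ≠ 0)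
    (k : Fin n) : pdy f k x y =
      fderiv ℝ (fun p : Vec n × Vec n => f p.1 p.2) (x, y) (0, Pi.single k 1) := by
  have h := (hf.differentiableAt hU hx hy).hasFDerivAt.comp (f := fun y' => (x, y')) y
    (hasFDerivAt_prodMk_right x y)
  have h' : fderiv ℝ (fun y' => f x y') y = _ := h.fderiv
  simp [pdy, h']

theorem SlitSmooth.congr (hf : SlitSmooth U f)
    (h : ∀ x ∈ U, ∀ y : Vec n, y ≠ 0 → g x y = f x y) : SlitSmooth U g :=
  ContDiffOn.congr hf fun p hp => h p.1 hp.1 p.2 hp.2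

theorem SlitSmooth.fderiv_apply (hf : SlitSmooth U f) (hU : IsOpen U) (v : Vec n × Vec n) :
    SlitSmooth U fun x y => fderiv ℝ (fun p : Vec n × Vec n => f p.1 p.2) (x, y) v :=
  (ContDiffOn.fderiv_of_isOpen hf (isOpen_slit hU) (m := (⊤ : ℕ∞)) (by simp)).clm_apply
    contDiffOn_const

theorem SlitSmooth.pdx (hf : SlitSmooth U f) (hU : IsOpen U) (k : Fin n) :
    SlitSmooth U (pdx f k) :=
  (hf.fderiv_apply hU _).congr fun _ hx _ hy => hf.pdx_eq hU hx hy k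

theorem SlitSmooth.pdy (hf : SlitSmooth U f) (hU : IsOpen U) (k : Fin n) :
    SlitSmooth U (pdy f k) :=
  (hf.fderiv_apply hU _).congr fun _ hx _ hy => hf.pdy_eq hU hx hy k

theorem pdx_congr (hU : IsOpen U) (h : ∀ x ∈ U, ∀ y : Vec n, y ≠ 0 → f x y = g x y)
    (hx : x ∈ U) (hy : y ≠ 0) (k : Fin n) : pdx f k x y = pdx g k x y := by
  have : (fun x' => f x' y) =ᶠ[nhds x] fun x' => g x' y := by
    filter_upwards [hU.mem_nhds hx] with x' hx' using h x' hx' y hy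
  simp only [pdx, this.fderiv_eq]

theorem pdy_congr (h : ∀ x ∈ U, ∀ y : Vec n, y ≠ 0 → f x y = g x y)
    (hx : x ∈ U) (hy : y ≠ 0) (k : Fin n) : pdy f k x y = pdy g k x y := by
  have : (fun y' => f x y') =ᶠ[nhds y] fun y' => g x y' := by
    filter_upwards [isOpen_ne.mem_nhds hy] with y' hy' using h x hx y' hy'
  simp only [pdy, this.fderiv_eq]

/-- Directional derivatives of a function smooth on the slit product commute. -/
theorem SlitSmooth.fderiv_fderiv_comm (hf : SlitSmooth U f) (hU : IsOpen U) (hx : x ∈ U)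
    (hy : y ≠ 0) (v w : Vec n × Vec n) :
    fderiv ℝ (fun q => fderiv ℝ (fun p : Vec n × Vec n => f p.1 p.2) q v) (x, y) w =
      fderiv ℝ (fun q => fderiv ℝ (fun p : Vec n × Vec n => f p.1 p.2) q w) (x, y) v := by
  have hc := hf.contDiffAt hU hx hy
  have hd : DifferentiableAt ℝ (fderiv ℝ fun p : Vec n × Vec n => f p.1 p.2) (x, y) :=
    (hc.fderiv_right (m := (⊤ : ℕ∞)) (by simp)).differentiableAt (by simp)
  have hs : IsSymmSndFDerivAt ℝ (fun p : Vec n × Vec n => f p.1 p.2) (x, y) :=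
    hc.isSymmSndFDerivAt (by simpa using ENat.LEInfty.out)
  rw [fderiv_clm_apply hd (differentiableAt_const v),
    fderiv_clm_apply hd (differentiableAt_const w)]
  simpa using hs w v

theorem SlitSmooth.pdy_pdy_comm (hf : SlitSmooth U f) (hU : IsOpen U) (hx : x ∈ U)
    (hy : y ≠ 0) (k l : Fin n) :
    _root_.pdy (_root_.pdy f k) l x y = _root_.pdy (_root_.pdy f l) k x y := by
  rw [pdy_congr (fun _ hx _ hy => hf.pdy_eq hU hx hy k) hx hy,
    pdy_congr (fun _ hx _ hy => hf.pdy_eq hU hx hy l) hx hy,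
    (hf.fderiv_apply hU _).pdy_eq hU hx hy, (hf.fderiv_apply hU _).pdy_eq hU hx hy]
  exact hf.fderiv_fderiv_comm hU hx hy _ _

theorem SlitSmooth.pdx_pdx_comm (hf : SlitSmooth U f) (hU : IsOpen U) (hx : x ∈ U)
    (hy : y ≠ 0) (k l : Fin n) :
    _root_.pdx (_root_.pdx f k) l x y = _root_.pdx (_root_.pdx f l) k x y := by
  rw [pdx_congr hU (fun _ hx _ hy => hf.pdx_eq hU hx hy k) hx hy,
    pdx_congr hU (fun _ hx _ hy => hf.pdx_eq hU hx hy l) hx hy,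
    (hf.fderiv_apply hU _).pdx_eq hU hx hy, (hf.fderiv_apply hU _).pdx_eq hU hx hy]
  exact hf.fderiv_fderiv_comm hU hx hy _ _

theorem SlitSmooth.pdy_pdx_comm (hf : SlitSmooth U f) (hU : IsOpen U) (hx : x ∈ U)
    (hy : y ≠ 0) (k l : Fin n) :
    _root_.pdy (_root_.pdx f k) l x y = _root_.pdx (_root_.pdy f l) k x y := by
  rw [pdy_congr (fun _ hx _ hy => hf.pdx_eq hU hx hy k) hx hy,
    pdx_congr hU (fun _ hx _ hy => hf.pdy_eq hU hx hy l) hx hy,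
    (hf.fderiv_apply hU _).pdy_eq hU hx hy, (hf.fderiv_apply hU _).pdx_eq hU hx hy]
  exact hf.fderiv_fderiv_comm hU hx hy _ _

theorem SlitSmooth.sub (hf : SlitSmooth U f) (hg : SlitSmooth U g) :
    SlitSmooth U fun x y => f x y - g x y := ContDiffOn.sub hf hg

theorem SlitSmooth.mul (hf : SlitSmooth U f) (hg : SlitSmooth U g) :
    SlitSmooth U fun x y => f x y * g x y := ContDiffOn.mul hf hg

theorem SlitSmooth.const_mul (hf : SlitSmooth U f) (c : ℝ) :
    SlitSmooth U fun x y => c * f x y := ContDiffOn.mul contDiffOn_const hf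

theorem SlitSmooth.sum {ι : Type*} {s : Finset ι} {F : ι → Vec n → Vec n → ℝ}
    (h : ∀ i, SlitSmooth U (F i)) : SlitSmooth U fun x y => ∑ i ∈ s, F i x y :=
  ContDiffOn.sum fun i _ => h i

theorem slitSmooth_coord (l : Fin n) : SlitSmooth U fun _ y => y l :=
  ContDiff.contDiffOn (by fun_prop)

theorem pdy_coord (k l : Fin n) (x y : Vec n) :
    pdy (fun _ y => y l) k x y = if l = k then 1 else 0 := by
  have h : HasFDerivAt (fun y' : Vec n => y' l)
      (ContinuousLinearMap.proj (R := ℝ) (φ := fun _ : Fin n => ℝ) l) y :=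
    (ContinuousLinearMap.proj (R := ℝ) (φ := fun _ : Fin n => ℝ) l).hasFDerivAt
  simp [pdy, h.fderiv, Pi.single_apply]

theorem pdy_sub (hU : IsOpen U) (hf : SlitSmooth U f) (hg : SlitSmooth U g) (hx : x ∈ U)
    (hy : y ≠ 0) (k : Fin n) :
    pdy (fun x y => f x y - g x y) k x y = pdy f k x y - pdy g k x y := by
  simp [pdy, fderiv_fun_sub (hf.differentiableAt_right hU hx hy)
    (hg.differentiableAt_right hU hx hy)]

theorem pdy_add (hU : IsOpen U) (hf : SlitSmooth U f) (hg : SlitSmooth U g) (hx : x ∈ U)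
    (hy : y ≠ 0) (k : Fin n) :
    pdy (fun x y => f x y + g x y) k x y = pdy f k x y + pdy g k x y := by
  simp [pdy, fderiv_fun_add (hf.differentiableAt_right hU hx hy)
    (hg.differentiableAt_right hU hx hy)]

theorem pdy_mul (hU : IsOpen U) (hf : SlitSmooth U f) (hg : SlitSmooth U g) (hx : x ∈ U)
    (hy : y ≠ 0) (k : Fin n) :
    pdy (fun x y => f x y * g x y) k x y = pdy f k x y * g x y + f x y * pdy g k x y := by
  simp [pdy, fderiv_fun_mul (hf.differentiableAt_right hU hx hy)
    (hg.differentiableAt_right hU hx hy)]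
  ring

theorem pdy_const_mul (c : ℝ) (f : Vec n → Vec n → ℝ) (k : Fin n) (x y : Vec n) :
    pdy (fun x y => c * f x y) k x y = c * pdy f k x y := by
  have : (fun y' => c * f x y') = c • fun y' => f x y' := rfl
  simp [pdy, this, fderiv_const_smul_field]

theorem pdx_const_mul (c : ℝ) (f : Vec n → Vec n → ℝ) (k : Fin n) (x y : Vec n) :
    pdx (fun x y => c * f x y) k x y = c * pdx f k x y := by
  have : (fun x' => c * f x' y) = c • fun x' => f x' y := rfl
  simp [pdx, this, fderiv_const_smul_field]

theorem pdx_coord_mul (l : Fin n) (f : Vec n → Vec n → ℝ) (k : Fin n) (x y : Vec n) :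
    pdx (fun x y => y l * f x y) k x y = y l * pdx f k x y :=
  pdx_const_mul (y l) f k x y

theorem pdy_sum (hU : IsOpen U) {ι : Type*} {s : Finset ι} {F : ι → Vec n → Vec n → ℝ}
    (h : ∀ i, SlitSmooth U (F i)) (hx : x ∈ U) (hy : y ≠ 0) (k : Fin n) :
    pdy (fun x y => ∑ i ∈ s, F i x y) k x y = ∑ i ∈ s, pdy (F i) k x y := by
  simp [pdy, fderiv_fun_sum fun i _ => (h i).differentiableAt_right hU hx hy]

theorem pdx_sum (hU : IsOpen U) {ι : Type*} {s : Finset ι} {F : ι → Vec n → Vec n → ℝ}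
    (h : ∀ i, SlitSmooth U (F i)) (hx : x ∈ U) (hy : y ≠ 0) (k : Fin n) :
    pdx (fun x y => ∑ i ∈ s, F i x y) k x y = ∑ i ∈ s, pdx (F i) k x y := by
  simp [pdx, fderiv_fun_sum fun i _ => (h i).differentiableAt_left hU hx hy]

/-- `(y^l F_l)_{·k} = F_k + y^l F_{l·k}`. -/
theorem pdy_sum_coord_mul (hU : IsOpen U) {F : Fin n → Vec n → Vec n → ℝ}
    (h : ∀ l, SlitSmooth U (F l)) (hx : x ∈ U) (hy : y ≠ 0) (k : Fin n) :
    pdy (fun x y => ∑ l, y l * F l x y) k x y = F k x y + ∑ l, y l * pdy (F l) k x y := by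
  rw [pdy_sum hU (fun l => (slitSmooth_coord l).mul (h l)) hx hy]
  simp [pdy_mul hU (slitSmooth_coord _) (h _) hx hy, pdy_coord, Finset.sum_add_distrib]

theorem eulerHom_of_homogeneous (hU : IsOpen U) (hf : SlitSmooth U f) (r : ℕ)
    (h : ∀ x y : Vec n, ∀ lam : ℝ, 0 < lam → f x (lam • y) = lam ^ r * f x y) :
    EulerHom U r f := by
  intro x hx y hy
  have hd := (hf.differentiableAt_right hU hx hy).hasFDerivAt
  have h1 : HasDerivAt (fun t : ℝ => f x (t • y)) (fderiv ℝ (fun y' => f x y') y y) 1 := by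
    have hl : HasDerivAt (fun t : ℝ => t • y) y 1 := by
      simpa using (hasDerivAt_id (1 : ℝ)).smul_const y
    have hd' : HasFDerivAt (fun y' => f x y') (fderiv ℝ (fun y' => f x y') y) ((1 : ℝ) • y) := by
      simpa using hd
    exact hd'.comp_hasDerivAt (1 : ℝ) hl
  have h2 : HasDerivAt (fun t : ℝ => t ^ r * f x y) (r * f x y) 1 := by
    simpa using (hasDerivAt_pow r (1 : ℝ)).mul_const (f x y)
  have h3 : (fun t : ℝ => f x (t • y)) =ᶠ[nhds 1] fun t => t ^ r * f x y := by
    filter_upwards [lt_mem_nhds (zero_lt_one (α := ℝ))] with t ht using h x y t ht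
  have h4 := h1.unique (h2.congr_of_eventuallyEq h3)
  rw [← h4]
  conv_rhs => arg 2; rw [pi_eq_sum_univ' y]
  rw [map_sum]
  refine Finset.sum_congr rfl fun l _ => ?_
  rw [map_smul, smul_eq_mul, pdy]

theorem EulerHom.pdy {r : ℝ} (h : EulerHom U r f) (hU : IsOpen U) (hf : SlitSmooth U f)
    (k : Fin n) : EulerHom U (r - 1) (pdy f k) := by
  intro x hx y hy
  have h1 := pdy_congr h hx hy k
  rw [pdy_const_mul, pdy_sum_coord_mul hU (fun l => hf.pdy hU l) hx hy] at h1
  simp only [hf.pdy_pdy_comm hU hx hy k]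
  linarith

theorem EulerHom.pdx {r : ℝ} (h : EulerHom U r f) (hU : IsOpen U) (hf : SlitSmooth U f)
    (k : Fin n) : EulerHom U r (pdx f k) := by
  intro x hx y hy
  have h1 := pdx_congr hU h hx hy k
  rw [pdx_const_mul, pdx_sum hU (fun l => (slitSmooth_coord l).mul (hf.pdy hU l)) hx hy] at h1
  simpa only [hf.pdy_pdx_comm hU hx hy k, pdx_coord_mul] using h1

end Calculus

section Curvature

variable {U : Set (Vec n)} {H : Fin n → Vec n → Vec n → ℝ} {x y : Vec n}

theorem SlitSmooth.Nc (hU : IsOpen U) (hH : ∀ i, SlitSmooth U (H i)) (i j : Fin n) :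
    SlitSmooth U (Nc H i j) := (hH i).pdy hU j

theorem SlitSmooth.Ga (hU : IsOpen U) (hH : ∀ i, SlitSmooth U (H i)) (i j k : Fin n) :
    SlitSmooth U (Ga H i j k) := (SlitSmooth.Nc hU hH i j).pdy hU k

theorem SlitSmooth.PiG (hU : IsOpen U) (hH : ∀ i, SlitSmooth U (H i)) : SlitSmooth U (PiG H) :=
  SlitSmooth.sum fun m => SlitSmooth.Nc hU hH m m

theorem Ga_comm (hU : IsOpen U) (hH : ∀ i, SlitSmooth U (H i)) (hx : x ∈ U) (hy : y ≠ 0)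
    (i j k : Fin n) : Ga H i j k x y = Ga H i k j x y :=
  (hH i).pdy_pdy_comm hU hx hy j k

theorem pdy_Ga_comm (hU : IsOpen U) (hH : ∀ i, SlitSmooth U (H i)) (hx : x ∈ U) (hy : y ≠ 0)
    (i j k l : Fin n) : pdy (Ga H i j k) l x y = pdy (Ga H i j l) k x y :=
  (SlitSmooth.Nc hU hH i j).pdy_pdy_comm hU hx hy k l

theorem pdy_PiG (hU : IsOpen U) (hH : ∀ i, SlitSmooth U (H i)) (hx : x ∈ U) (hy : y ≠ 0)
    (k : Fin n) : pdy (PiG H) k x y = ∑ m, Ga H m m k x y :=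
  pdy_sum hU (fun m => SlitSmooth.Nc hU hH m m) hx hy k

theorem pdx_PiG (hU : IsOpen U) (hH : ∀ i, SlitSmooth U (H i)) (hx : x ∈ U) (hy : y ≠ 0)
    (k : Fin n) : pdx (PiG H) k x y = ∑ m, pdx (Nc H m m) k x y :=
  pdx_sum hU (fun m => SlitSmooth.Nc hU hH m m) hx hy k

theorem pdx_pdy_PiG (hU : IsOpen U) (hH : ∀ i, SlitSmooth U (H i)) (hx : x ∈ U) (hy : y ≠ 0)
    (k l : Fin n) : pdx (pdy (PiG H) k) l x y = ∑ m, pdx (Ga H m m k) l x y := by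
  rw [pdx_congr hU (fun _ hx _ hy => pdy_PiG hU hH hx hy k) hx hy,
    pdx_sum hU (fun m => SlitSmooth.Ga hU hH m m k) hx hy]

theorem pdy_pdy_PiG (hU : IsOpen U) (hH : ∀ i, SlitSmooth U (H i)) (hx : x ∈ U) (hy : y ≠ 0)
    (k l : Fin n) : pdy (pdy (PiG H) k) l x y = ∑ m, pdy (Ga H m m k) l x y := by
  rw [pdy_congr (fun _ hx _ hy => pdy_PiG hU hH hx hy k) hx hy,
    pdy_sum hU (fun m => SlitSmooth.Ga hU hH m m k) hx hy]

theorem sum_mul_Nc (hE : ∀ i, EulerHom U 2 (H i)) (hx : x ∈ U) (hy : y ≠ 0) (i : Fin n) :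
    ∑ l, y l * Nc H i l x y = 2 * H i x y := hE i x hx y hy

theorem sum_mul_Ga (hU : IsOpen U) (hH : ∀ i, SlitSmooth U (H i))
    (hE : ∀ i, EulerHom U 2 (H i)) (hx : x ∈ U) (hy : y ≠ 0) (i j : Fin n) :
    ∑ l, y l * Ga H i j l x y = Nc H i j x y := by
  have := (hE i).pdy hU (hH i) j x hx y hy
  norm_num at this
  exact this

theorem sum_mul_pdx_Ga (hU : IsOpen U) (hH : ∀ i, SlitSmooth U (H i))
    (hE : ∀ i, EulerHom U 2 (H i)) (hx : x ∈ U) (hy : y ≠ 0) (i j k : Fin n) :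
    ∑ l, y l * pdx (Ga H i j l) k x y = pdx (Nc H i j) k x y := by
  have := pdx_congr hU (fun _ hx _ hy => sum_mul_Ga hU hH hE hx hy i j) hx hy k
  rw [← this, pdx_sum hU (fun l => (slitSmooth_coord l).mul (SlitSmooth.Ga hU hH i j l)) hx hy]
  simp only [pdx_coord_mul]

theorem sum_mul_pdx_Nc (hU : IsOpen U) (hH : ∀ i, SlitSmooth U (H i))
    (hE : ∀ i, EulerHom U 2 (H i)) (hx : x ∈ U) (hy : y ≠ 0) (i k : Fin n) :
    ∑ l, y l * pdx (Nc H i l) k x y = 2 * pdx (H i) k x y := by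
  have := pdx_congr hU (fun _ hx _ hy => sum_mul_Nc hE hx hy i) hx hy k
  rw [← pdx_const_mul, ← this,
    pdx_sum hU (fun l => (slitSmooth_coord l).mul (SlitSmooth.Nc hU hH i l)) hx hy]
  simp only [pdx_coord_mul]

theorem sum_mul_pdy_Ga (hU : IsOpen U) (hH : ∀ i, SlitSmooth U (H i))
    (hE : ∀ i, EulerHom U 2 (H i)) (hx : x ∈ U) (hy : y ≠ 0) (i j m : Fin n) :
    ∑ l, y l * pdy (Ga H i j l) m x y = 0 := by
  have := pdy_congr (fun _ hx _ hy => sum_mul_Ga hU hH hE hx hy i j) hx hy m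
  rw [pdy_sum_coord_mul hU (fun l => SlitSmooth.Ga hU hH i j l) hx hy] at this
  simpa [_root_.Ga] using this

/-- `y^l δΓ^i_{jl}/δx^k = ∂N^i_j/∂x^k`. -/
theorem sum_mul_hd_Ga (hU : IsOpen U) (hH : ∀ i, SlitSmooth U (H i))
    (hE : ∀ i, EulerHom U 2 (H i)) (hx : x ∈ U) (hy : y ≠ 0) (i j k : Fin n) :
    ∑ l, y l * hd H (Ga H i j l) k x y = pdx (Nc H i j) k x y := by
  simp only [hd, mul_sub, Finset.sum_sub_distrib, sum_mul_pdx_Ga hU hH hE hx hy, Finset.mul_sum]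
  rw [Finset.sum_comm]
  simp only [mul_left_comm (y _) (Nc _ _ _ _ _), ← Finset.mul_sum,
    sum_mul_pdy_Ga hU hH hE hx hy, mul_zero, Finset.sum_const_zero, sub_zero]

theorem hd_congr (hU : IsOpen U) {f g : Vec n → Vec n → ℝ}
    (h : ∀ x ∈ U, ∀ y : Vec n, y ≠ 0 → f x y = g x y) (hx : x ∈ U) (hy : y ≠ 0) (k : Fin n) :
    hd H f k x y = hd H g k x y := by
  simp only [hd, pdx_congr hU h hx hy, pdy_congr h hx hy]

/-- `y^l R_j{}^i{}_{kl}`, summed over `l` only. -/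
theorem sum_Riem4_mul (hU : IsOpen U) (hH : ∀ i, SlitSmooth U (H i))
    (hE : ∀ i, EulerHom U 2 (H i)) (hx : x ∈ U) (hy : y ≠ 0) (i j k : Fin n) :
    ∑ l, Riem4 H j i k l x y * y l =
      pdx (Nc H i j) k x y - ∑ l, y l * hd H (Ga H i k j) l x y
        + ∑ s, (Ga H i k s x y * Nc H s j x y - Ga H s k j x y * Nc H i s x y) := by
  have h1 : ∀ l, Riem4 H j i k l x y * y l = y l * hd H (Ga H i j l) k x y
      - y l * hd H (Ga H i k j) l x y
      + ∑ s, (Ga H i k s x y * (y l * Ga H s j l x y)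
        - Ga H s k j x y * (y l * Ga H i s l x y)) := by
    intro l
    rw [Riem4, hd_congr hU (fun _ hx _ hy => Ga_comm hU hH hx hy i j k) hx hy, add_mul, sub_mul,
      Finset.sum_mul]
    congr 1
    · ring
    · refine Finset.sum_congr rfl fun s _ => ?_
      rw [Ga_comm hU hH hx hy s j k, Ga_comm hU hH hx hy i l s]
      ring
  simp only [h1, Finset.sum_add_distrib, Finset.sum_sub_distrib, sum_mul_hd_Ga hU hH hE hx hy]
  congr 1
  rw [Finset.sum_comm, Finset.sum_comm (s := Finset.univ (α := Fin n))
    (f := fun l s => Ga H s k j x y * (y l * Ga H i s l x y))]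
  simp only [← Finset.mul_sum, sum_mul_Ga hU hH hE hx hy]

/-- `R^i_k = 2 ∂G^i/∂x^k - y^l ∂N^i_k/∂x^l + 2 G^s Γ^i_{ks} - N^i_s N^s_k`. -/
theorem Riem2_eq (hU : IsOpen U) (hH : ∀ i, SlitSmooth U (H i))
    (hE : ∀ i, EulerHom U 2 (H i)) (i k : Fin n) :
    ∀ x ∈ U, ∀ y : Vec n, y ≠ 0 → Riem2 H i k x y =
      2 * pdx (H i) k x y - ∑ l, y l * pdx (Nc H i k) l x y
        + ∑ s, (2 * (H s x y * Ga H i k s x y) - Nc H i s x y * Nc H s k x y) := by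
  intro x hx y hy
  have h1 : Riem2 H i k x y = ∑ j, y j * ∑ l, Riem4 H j i k l x y * y l := by
    simp only [Riem2, Finset.mul_sum, mul_assoc]
  rw [h1]
  simp only [sum_Riem4_mul hU hH hE hx hy, mul_add, mul_sub, Finset.sum_add_distrib,
    Finset.sum_sub_distrib, sum_mul_pdx_Nc hU hH hE hx hy, Finset.mul_sum]
  have h2 : ∑ j, ∑ l, y j * (y l * hd H (Ga H i k j) l x y)
      = ∑ l, y l * pdx (Nc H i k) l x y := by
    rw [Finset.sum_comm]
    simp only [mul_left_comm (y _) (y _), ← Finset.mul_sum, sum_mul_hd_Ga hU hH hE hx hy]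
  have h3 : ∑ j, ∑ s, y j * (Ga H i k s x y * Nc H s j x y)
      = ∑ s, 2 * (H s x y * Ga H i k s x y) := by
    rw [Finset.sum_comm]
    simp only [mul_left_comm (y _) (Ga _ _ _ _ _ _), ← Finset.mul_sum, sum_mul_Nc hE hx hy]
    rw [Finset.mul_sum]
    exact Finset.sum_congr rfl fun s _ => by ring
  have h4 : ∑ j, ∑ s, y j * (Ga H s k j x y * Nc H i s x y)
      = ∑ s, Nc H i s x y * Nc H s k x y := by
    rw [Finset.sum_comm]
    simp only [← mul_assoc, ← Finset.sum_mul, sum_mul_Ga hU hH hE hx hy]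
    exact Finset.sum_congr rfl fun s _ => mul_comm _ _
  rw [h2, h3, h4]

theorem pdy_Riem2 (hU : IsOpen U) (hH : ∀ i, SlitSmooth U (H i))
    (hE : ∀ i, EulerHom U 2 (H i)) (hx : x ∈ U) (hy : y ≠ 0) (i k m : Fin n) :
    pdy (Riem2 H i k) m x y =
      2 * pdx (Nc H i m) k x y - (pdx (Nc H i k) m x y + ∑ l, y l * pdx (Ga H i k m) l x y)
        + ∑ s, (2 * (Nc H s m x y * Ga H i k s x y + H s x y * pdy (Ga H i k s) m x y)
          - (Ga H i s m x y * Nc H s k x y + Nc H i s x y * Ga H s k m x y)) := by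
  have hN := SlitSmooth.Nc hU hH
  have hΓ := SlitSmooth.Ga hU hH
  have s1 := ((hH i).pdx hU k).const_mul 2
  have s2 : SlitSmooth U fun x y => ∑ l, y l * pdx (Nc H i k) l x y :=
    SlitSmooth.sum fun l => (slitSmooth_coord l).mul ((hN i k).pdx hU l)
  have s3 : ∀ s, SlitSmooth U fun x y => 2 * (H s x y * Ga H i k s x y) :=
    fun s => ((hH s).mul (hΓ i k s)).const_mul 2
  have s4 : ∀ s, SlitSmooth U fun x y => Nc H i s x y * Nc H s k x y :=
    fun s => (hN i s).mul (hN s k)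
  have s5 := fun s => (s3 s).sub (s4 s)
  rw [pdy_congr (Riem2_eq hU hH hE i k) hx hy, pdy_add hU (s1.sub s2) (SlitSmooth.sum s5) hx hy,
    pdy_sub hU s1 s2 hx hy, pdy_sum hU s5 hx hy, pdy_const_mul, (hH i).pdy_pdx_comm hU hx hy,
    pdy_sum_coord_mul hU (fun l => (hN i k).pdx hU l) hx hy]
  simp only [(hN i k).pdy_pdx_comm hU hx hy, pdy_sub hU (s3 _) (s4 _) hx hy, pdy_const_mul,
    pdy_mul hU (hH _) (hΓ _ _ _) hx hy, pdy_mul hU (hN _ _) (hN _ _) hx hy]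
  rfl

/-- The χ-curvature is determined by `Π` and the spray coefficients:
`χ_k = -(1/2) (Π_{x^k} - y^l Π_{·k x^l} + 2 G^s Π_{·k·s})`. -/
theorem chi_eq (hU : IsOpen U) (hH : ∀ i, SlitSmooth U (H i))
    (hE : ∀ i, EulerHom U 2 (H i)) (hx : x ∈ U) (hy : y ≠ 0) (k : Fin n) :
    chi H k x y = -(1 / 2) * (pdx (PiG H) k x y - ∑ l, y l * pdx (pdy (PiG H) k) l x y
      + 2 * ∑ s, H s x y * pdy (pdy (PiG H) k) s x y) := by
  have hΓ : ∀ i j k, Ga H i j k x y = Ga H i k j x y := Ga_comm hU hH hx hy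
  have hdx : ∀ m l, pdx (Ga H m k m) l x y = pdx (Ga H m m k) l x y := fun m l =>
    pdx_congr hU (fun _ hx _ hy => Ga_comm hU hH hx hy m k m) hx hy l
  have hdy : ∀ m s, pdy (Ga H m k s) m x y = pdy (Ga H m m k) s x y := fun m s => by
    rw [pdy_Ga_comm hU hH hx hy]
    exact pdy_congr (fun _ hx _ hy => Ga_comm hU hH hx hy m k m) hx hy s
  have hdy' : ∀ m s, pdy (Ga H m m s) k x y = pdy (Ga H m m k) s x y := fun m s =>
    pdy_Ga_comm hU hH hx hy m m s k
  have e1 : ∑ m, ∑ l, y l * pdx (Ga H m m k) l x y = ∑ l, y l * pdx (pdy (PiG H) k) l x y := by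
    rw [Finset.sum_comm]
    simp only [← Finset.mul_sum, pdx_pdy_PiG hU hH hx hy]
  have e2 : ∑ m, ∑ s, H s x y * pdy (Ga H m m k) s x y
      = ∑ s, H s x y * pdy (pdy (PiG H) k) s x y := by
    rw [Finset.sum_comm]
    simp only [← Finset.mul_sum, pdy_pdy_PiG hU hH hx hy]
  have e3 : ∑ m, ∑ s, Nc H s m x y * Ga H m k s x y
      = ∑ m, ∑ s, Nc H m s x y * Ga H s m k x y := by
    rw [Finset.sum_comm]
    simp only [hΓ _ k]
  have e4 : ∑ m, ∑ s, Ga H m s k x y * Nc H s m x y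
      = ∑ m, ∑ s, Nc H m s x y * Ga H s m k x y := by
    rw [Finset.sum_comm]
    simp only [mul_comm]
  have e5 : ∑ m, ∑ s, Nc H s k x y * Ga H m m s x y
      = ∑ m, ∑ s, Ga H m s m x y * Nc H s k x y := by
    simp only [hΓ _ _ _, mul_comm]
  have e6 : ∑ m, ∑ s, Nc H m s x y * Ga H s k m x y
      = ∑ m, ∑ s, Nc H m s x y * Ga H s m k x y := by
    simp only [hΓ _ k]
  simp only [chi, pdy_Riem2 hU hH hE hx hy, pdx_PiG hU hH hx hy, Finset.sum_add_distrib,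
    Finset.sum_sub_distrib, hdx, hdy, hdy', mul_add, ← Finset.mul_sum]
  rw [← e1, ← e2, e3, e4, e5, e6]
  ring

/-- If `Π = y^m ∂s/∂x^m` for a function `s` of `x` alone, then `χ = 0`. -/
theorem chi_eq_zero_of_PiG_eq (hU : IsOpen U) (hH : ∀ i, SlitSmooth U (H i))
    (hE : ∀ i, EulerHom U 2 (H i)) {s : Vec n → ℝ} (hs : SlitSmooth U fun x _ => s x)
    (hP : ∀ x ∈ U, ∀ y : Vec n, y ≠ 0 → PiG H x y = ∑ m, y m * pdx (fun x _ => s x) m x y)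
    (hx : x ∈ U) (hy : y ≠ 0) (k : Fin n) : chi H k x y = 0 := by
  have h0 : ∀ l m (x y : Vec n), pdy (pdx (fun x _ => s x) l) m x y = 0 := fun l m x y => by
    simp [pdy, pdx]
  have h1 : ∀ x ∈ U, ∀ y : Vec n, y ≠ 0 →
      pdy (PiG H) k x y = pdx (fun x _ => s x) k x y := fun x hx y hy => by
    rw [pdy_congr hP hx hy, pdy_sum_coord_mul hU (fun l => hs.pdx hU l) hx hy]
    simp [h0]
  have h2 : pdx (PiG H) k x y = ∑ l, y l * pdx (pdx (fun x _ => s x) k) l x y := by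
    rw [pdx_congr hU hP hx hy,
      pdx_sum hU (fun l => (slitSmooth_coord l).mul (hs.pdx hU l)) hx hy]
    simp only [pdx_coord_mul, hs.pdx_pdx_comm hU hx hy k]
  rw [chi_eq hU hH hE hx hy, h2]
  simp [pdx_congr hU h1 hx hy, pdy_congr h1 hx hy, h0]

end Curvature

section AssociatedSpray

variable {U : Set (Vec n)} {G : Fin n → Vec n → Vec n → ℝ} {σ : Vec n → ℝ}

theorem IsVolumeForm.slitSmooth_log (hσ : IsVolumeForm U σ) :
    SlitSmooth U fun x _ => Real.log (σ x) :=
  (hσ.1.log fun x hx => (hσ.2 x hx).ne').comp contDiffOn_fst fun _ hp => hp.1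

theorem IsSpray.slitSmooth (hG : IsSpray U G) (i : Fin n) : SlitSmooth U (G i) := hG.1 i

theorem IsSpray.eulerHom (hU : IsOpen U) (hG : IsSpray U G) (i : Fin n) :
    EulerHom U 2 (G i) :=
  eulerHom_of_homogeneous hU (hG.slitSmooth i) 2 (hG.2 i)

theorem SlitSmooth.Scurv (hU : IsOpen U) (hG : IsSpray U G) (hσ : IsVolumeForm U σ) :
    SlitSmooth U (Scurv G σ) :=
  (SlitSmooth.PiG hU hG.slitSmooth).sub <| SlitSmooth.sum fun m =>
    (slitSmooth_coord m).mul (hσ.slitSmooth_log.pdx hU m)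

theorem EulerHom.Scurv (hU : IsOpen U) (hG : IsSpray U G) (hσ : IsVolumeForm U σ) :
    EulerHom U 1 (Scurv G σ) := by
  intro x hx y hy
  have hs := hσ.slitSmooth_log.pdx hU
  have h1 : ∀ l, _root_.pdy (_root_.Scurv G σ) l x y = ∑ m, _root_.Ga G m m l x y
      - _root_.pdx (fun x _ => Real.log (σ x)) l x y := by
    intro l
    have h2 : _root_.pdy (_root_.Scurv G σ) l x y = _ := pdy_sub hU
      (SlitSmooth.PiG hU hG.slitSmooth)
      (SlitSmooth.sum (s := Finset.univ) fun m => (slitSmooth_coord m).mul (hs m)) hx hy l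
    rw [h2, pdy_PiG hU hG.slitSmooth hx hy, pdy_sum_coord_mul hU hs hx hy]
    simp [_root_.pdy, _root_.pdx]
  simp only [h1, mul_sub, Finset.sum_sub_distrib, Finset.mul_sum]
  rw [Finset.sum_comm]
  simp only [sum_mul_Ga hU hG.slitSmooth (hG.eulerHom hU) hx hy]
  rw [one_mul]
  rfl

theorem SlitSmooth.Ghat (hU : IsOpen U) (hG : IsSpray U G) (hσ : IsVolumeForm U σ) (i : Fin n) :
    SlitSmooth U (Ghat G σ i) :=
  (hG.slitSmooth i).sub <| SlitSmooth.mul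
    (ContDiffOn.div_const (SlitSmooth.Scurv hU hG hσ) _) (slitSmooth_coord i)

theorem pdy_Ghat (hU : IsOpen U) (hG : IsSpray U G) (hσ : IsVolumeForm U σ) {x y : Vec n}
    (hx : x ∈ U) (hy : y ≠ 0) (i j : Fin n) :
    pdy (Ghat G σ i) j x y = Nc G i j x y - ((n : ℝ) + 1)⁻¹ *
      (pdy (Scurv G σ) j x y * y i + Scurv G σ x y * if i = j then 1 else 0) := by
  have hS := SlitSmooth.Scurv hU hG hσ
  have h : Ghat G σ i = fun x y => G i x y - ((n : ℝ) + 1)⁻¹ * (Scurv G σ x y * y i) := by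
    funext x y
    rw [Ghat]
    ring
  rw [h, pdy_sub hU (hG.slitSmooth i) ((hS.mul (slitSmooth_coord i)).const_mul _) hx hy,
    pdy_const_mul, pdy_mul hU hS (slitSmooth_coord i) hx hy, pdy_coord, Nc]

theorem EulerHom.Ghat (hU : IsOpen U) (hG : IsSpray U G) (hσ : IsVolumeForm U σ) (i : Fin n) :
    EulerHom U 2 (Ghat G σ i) := by
  intro x hx y hy
  have hS := EulerHom.Scurv hU hG hσ x hx y hy
  have hN := sum_mul_Nc (hG.eulerHom hU) hx hy i
  have h1 : ∀ l, y l * _root_.pdy (_root_.Ghat G σ i) l x y = y l * Nc G i l x y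
      - ((n : ℝ) + 1)⁻¹ * (y i * (y l * _root_.pdy (_root_.Scurv G σ) l x y)
        + _root_.Scurv G σ x y * (y l * if i = l then 1 else 0)) := fun l => by
    rw [pdy_Ghat hU hG hσ hx hy]
    ring
  simp only [h1, Finset.sum_sub_distrib, ← Finset.mul_sum, Finset.sum_add_distrib, hN, hS,
    mul_ite, mul_one, mul_zero, Finset.sum_ite_eq, Finset.mem_univ, if_true, _root_.Ghat]
  ring

/-- `Π̂ = Π - S = y^m ∂(ln σ)/∂x^m`. -/
theorem PiG_Ghat (hU : IsOpen U) (hG : IsSpray U G) (hσ : IsVolumeForm U σ) {x y : Vec n}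
    (hx : x ∈ U) (hy : y ≠ 0) :
    PiG (Ghat G σ) x y = ∑ m, y m * pdx (fun x _ => Real.log (σ x)) m x y := by
  have hS := EulerHom.Scurv hU hG hσ x hx y hy
  have hn : (n : ℝ) + 1 ≠ 0 := by positivity
  have h1 : PiG (Ghat G σ) x y = PiG G x y - Scurv G σ x y := by
    simp only [PiG, Nc.eq_1 (Ghat G σ), pdy_Ghat hU hG hσ hx hy, Finset.sum_sub_distrib,
      ← Finset.mul_sum, Finset.sum_add_distrib, mul_comm (pdy _ _ _ _) (y _), hS]
    simp
    field_simp
    ring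
  rw [h1, Scurv, sub_sub_cancel]
  rfl

end AssociatedSpray

/-- the spray `Ĝ` associated with `(G, dV)` has vanishing χ-curvature. -/
theorem chi_of_associated_spray_vanishes
    {n : ℕ} (hn : 2 ≤ n) (U : Set (Vec n)) (hU : IsOpen U)
    (G : Fin n → Vec n → Vec n → ℝ) (hG : IsSpray U G)
    (σ : Vec n → ℝ) (hσ : IsVolumeForm U σ) :
    ∀ x ∈ U, ∀ y : Vec n, y ≠ 0 → ∀ k, chi (Ghat G σ) k x y = 0 := by
  intro x hx y hy k
  exact chi_eq_zero_of_PiG_eq hU (SlitSmooth.Ghat hU hG hσ) (EulerHom.Ghat hU hG hσ)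
    hσ.slitSmooth_log (fun _ hx _ hy => PiG_Ghat hU hG hσ hx hy) hx hy k
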